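/- arXiv:1910.03796 — 4 statements merged into one kernel-verified Lean document; each statement's English description precedes it below -/
import Mathlib

section
/- Let A, B : {0,1} → {0,1} → ℝ be binary channels, i.e., A(i|x) ≥ 0, B(j|y) ≥ 0 and ∑_i A(i|x) = ∑_j B(j|y) = 1 for all x,y ∈ {0,1}. Define w(c|a,b) := (1/4)·∑_{x,y,i,j ∈ {0,1}} A(i|x)·B(j|y)·[c = x·y ⊕ i ⊕ j ⊕ a ⊕ b]. Then there exists ν ∈ [1/4, 3/4] such that w(c|a,b) = BSC(ν)(c | a⊕b) for all a,b,c ∈ {0,1}. In words: whatever local modulation strategies Alice and Bob use, the effective multiple-access channel is the binary adder channel followed by a binary symmetric channel with flip probability between 1/4 and 3/4. -/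
/-- The binary symmetric channel with flip probability `ν`:
`bsc ν c z` is the probability of output `c` given input `z`. -/
noncomputable def bsc (ν : ℝ) (c z : ZMod 2) : ℝ := if c = z then 1 - ν else ν

/-- The CHSH inequality for real numbers of absolute value at most one. -/
theorem abs_chsh_le_two {s₀ s₁ t₀ t₁ : ℝ} (hs₀ : |s₀| ≤ 1) (hs₁ : |s₁| ≤ 1)
    (ht₀ : |t₀| ≤ 1) (ht₁ : |t₁| ≤ 1) :
    |s₀ * t₀ + s₀ * t₁ + s₁ * t₀ - s₁ * t₁| ≤ 2 := by
  have h : |t₀ + t₁| + |t₀ - t₁| ≤ 2 := by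
    rw [abs_le] at ht₀ ht₁
    rcases abs_cases (t₀ + t₁) with h₁ | h₁ <;> rcases abs_cases (t₀ - t₁) with h₂ | h₂ <;>
      linarith
  calc |s₀ * t₀ + s₀ * t₁ + s₁ * t₀ - s₁ * t₁|
      = |s₀ * (t₀ + t₁) + s₁ * (t₀ - t₁)| := by ring_nf
    _ ≤ |s₀| * |t₀ + t₁| + |s₁| * |t₀ - t₁| := by
        simpa only [abs_mul] using abs_add_le (s₀ * (t₀ + t₁)) (s₁ * (t₀ - t₁))
    _ ≤ 1 * |t₀ + t₁| + 1 * |t₀ - t₁| := by gcongr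
    _ ≤ 2 := by linarith

/-- The bias of a probability distribution on a bit has absolute value at most one. -/
theorem abs_two_mul_sub_one_le_one {p : ZMod 2 → ℝ} (h₀ : ∀ i, 0 ≤ p i)
    (h₁ : p 0 + p 1 = 1) : |2 * p 0 - 1| ≤ 1 := by
  rw [abs_le]
  constructor <;> linarith [h₀ 0, h₀ 1]

/-- Whatever local (deterministic or private-randomness) modulation
strategies `A`, `B` Alice and Bob use, the effective multiple-access channel
`w(c|a,b) = (1/4)·∑_{x,y,i,j} A(i|x) B(j|y) [c = x·y ⊕ i ⊕ j ⊕ a ⊕ b]` is the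
binary adder channel followed by a BSC with flip probability `ν ∈ [1/4, 3/4]`. -/
theorem classical_modulation_is_bsc_adder
    (A B : ZMod 2 → ZMod 2 → ℝ)
    (hA0 : ∀ x i, 0 ≤ A x i) (hA1 : ∀ x, ∑ i, A x i = 1)
    (hB0 : ∀ y j, 0 ≤ B y j) (hB1 : ∀ y, ∑ j, B y j = 1) :
    ∃ ν ∈ Set.Icc (1/4 : ℝ) (3/4),
      ∀ a b c : ZMod 2,
        (1/4 : ℝ) * ∑ x : ZMod 2, ∑ y : ZMod 2, ∑ i : ZMod 2, ∑ j : ZMod 2,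
            A x i * B y j * (if c = x * y + i + j + a + b then 1 else 0)
          = bsc ν c (a + b) := by
  have hsum (f : ZMod 2 → ℝ) : ∑ i, f i = f 0 + f 1 := Fin.sum_univ_two f
  simp only [hsum] at hA1 hB1 ⊢
  have hchsh := abs_le.mp <| abs_chsh_le_two
    (abs_two_mul_sub_one_le_one (hA0 0) (hA1 0)) (abs_two_mul_sub_one_le_one (hA0 1) (hA1 1))
    (abs_two_mul_sub_one_le_one (hB0 0) (hB1 0)) (abs_two_mul_sub_one_le_one (hB0 1) (hB1 1))
  have hA (x) : A x 1 = 1 - A x 0 := by linarith [hA1 x]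
  have hB (y) : B y 1 = 1 - B y 0 := by linarith [hB1 y]
  refine ⟨1 / 2 - ((2 * A 0 0 - 1) * (2 * B 0 0 - 1) + (2 * A 0 0 - 1) * (2 * B 1 0 - 1) +
    (2 * A 1 0 - 1) * (2 * B 0 0 - 1) - (2 * A 1 0 - 1) * (2 * B 1 0 - 1)) / 8,
    ⟨by linarith [hchsh.2], by linarith [hchsh.1]⟩, fun a b c => ?_⟩
  have hbit (z : ZMod 2) : z = 0 ∨ z = 1 := by revert z; decide
  have h11 : (1 : ZMod 2) + 1 = 0 := by decide
  simp only [bsc, hA, hB]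
  rcases hbit a with rfl | rfl <;> rcases hbit b with rfl | rfl <;>
    rcases hbit c with rfl | rfl <;> simp [h11] <;> ring
end

section
/- Let E be a finite set, p a probability distribution on E, and let A : E × {0,1} → probability distributions on {0,1} and B : E × {0,1} → probability distributions on {0,1} be conditional distributions (a local correlation shared by Alice and Bob). Define w(c|a,b) := (1/4)·∑_{e ∈ E} ∑_{x,y,i,j ∈ {0,1}} p(e)·A(i|e,x)·B(j|e,y)·[c = x·y ⊕ i ⊕ j ⊕ a ⊕ b]. Then there exists ν ∈ [1/4, 3/4] such that w(c|a,b) = BSC(ν)(c | a⊕b) for all a,b,c ∈ {0,1}. -/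
theorem ZMod.sum_univ_two {M : Type*} [AddCommMonoid M] (f : ZMod 2 → M) :
    ∑ i, f i = f 0 + f 1 :=
  Fin.sum_univ_two f

/-- The CHSH combination of two `±1`-biases per party. -/
def chsh (u v : ZMod 2 → ℝ) : ℝ := u 0 * v 0 + u 0 * v 1 + u 1 * v 0 - u 1 * v 1

/-- The bias `P 0 - P 1` of each of the conditional distributions `P` of a bit. -/
def bias (P : ZMod 2 → ZMod 2 → ℝ) (x : ZMod 2) : ℝ := P x 0 - P x 1

theorem abs_chsh_le_two_s2 {u v : ZMod 2 → ℝ} (hu : ∀ x, |u x| ≤ 1) (hv : ∀ y, |v y| ≤ 1) :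
    |chsh u v| ≤ 2 := by
  have hsplit : chsh u v = u 0 * (v 0 + v 1) + u 1 * (v 0 - v 1) := by unfold chsh; ring
  have hv0 := abs_le.1 (hv 0)
  have hv1 := abs_le.1 (hv 1)
  calc |chsh u v| ≤ |u 0| * |v 0 + v 1| + |u 1| * |v 0 - v 1| := by
        rw [hsplit, ← abs_mul, ← abs_mul]
        exact abs_add_le _ _
    _ ≤ 1 * |v 0 + v 1| + 1 * |v 0 - v 1| := by gcongr <;> exact hu _
    _ ≤ 2 := by
        rcases abs_cases (v 0 + v 1) with h | h <;> rcases abs_cases (v 0 - v 1) with h' | h' <;>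
          linarith

theorem abs_bias_le_one {P : ZMod 2 → ZMod 2 → ℝ} (h0 : ∀ x i, 0 ≤ P x i)
    (h1 : ∀ x, ∑ i, P x i = 1) (x : ZMod 2) : |bias P x| ≤ 1 := by
  have h := h1 x
  rw [ZMod.sum_univ_two] at h
  have := h0 x 0
  have := h0 x 1
  rw [bias, abs_le]
  constructor <;> linarith

theorem sum_mul_ite_eq_chsh {P Q : ZMod 2 → ZMod 2 → ℝ} (hP : ∀ x, ∑ i, P x i = 1)
    (hQ : ∀ y, ∑ j, Q y j = 1) (a b c : ZMod 2) :
    ∑ x : ZMod 2, ∑ y : ZMod 2, ∑ i : ZMod 2, ∑ j : ZMod 2,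
        P x i * Q y j * (if c = x * y + i + j + a + b then 1 else 0)
      = 2 + (if c = a + b then 1 else -1) * chsh (bias P) (bias Q) / 2 := by
  simp only [ZMod.sum_univ_two] at hP hQ ⊢
  have hP' (x) : P x 1 = 1 - P x 0 := by linarith [hP x]
  have hQ' (y) : Q y 1 = 1 - Q y 0 := by linarith [hQ y]
  have hbit (z : ZMod 2) : z = 0 ∨ z = 1 := by revert z; decide
  have h11 : (1 : ZMod 2) + 1 = 0 := rfl
  rcases hbit a with rfl | rfl <;> rcases hbit b with rfl | rfl <;>
    rcases hbit c with rfl | rfl <;>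
    simp [chsh, bias, hP', hQ', h11] <;> ring

/-- For any local correlation (shared randomness `p` on a finite set `E`
together with conditional distributions `A(i|e,x)` and `B(j|e,y)`), the induced
effective multiple-access channel is the binary adder channel followed by a BSC with
flip probability `ν ∈ [1/4, 3/4]`. -/
theorem local_correlation_modulation_is_bsc_adder
    {E : Type*} [Fintype E]
    (p : E → ℝ) (hp0 : ∀ e, 0 ≤ p e) (hp1 : ∑ e, p e = 1)
    (A B : E → ZMod 2 → ZMod 2 → ℝ)
    (hA0 : ∀ e x i, 0 ≤ A e x i) (hA1 : ∀ e x, ∑ i, A e x i = 1)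
    (hB0 : ∀ e y j, 0 ≤ B e y j) (hB1 : ∀ e y, ∑ j, B e y j = 1) :
    ∃ ν ∈ Set.Icc (1/4 : ℝ) (3/4),
      ∀ a b c : ZMod 2,
        (1/4 : ℝ) * ∑ e : E, ∑ x : ZMod 2, ∑ y : ZMod 2, ∑ i : ZMod 2, ∑ j : ZMod 2,
            p e * A e x i * B e y j * (if c = x * y + i + j + a + b then 1 else 0)
          = bsc ν c (a + b) := by
  have hS (e : E) : |chsh (bias (A e)) (bias (B e))| ≤ 2 :=
    abs_chsh_le_two_s2 (abs_bias_le_one (hA0 e) (hA1 e)) (abs_bias_le_one (hB0 e) (hB1 e))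
  set T := ∑ e, p e * chsh (bias (A e)) (bias (B e)) with hT
  have hT2 : |T| ≤ 2 :=
    calc |T| ≤ ∑ e, |p e * chsh (bias (A e)) (bias (B e))| := Finset.abs_sum_le_sum_abs _ _
      _ ≤ ∑ e, p e * 2 := by
        refine Finset.sum_le_sum fun e _ => ?_
        rw [abs_mul, abs_of_nonneg (hp0 e)]
        exact mul_le_mul_of_nonneg_left (hS e) (hp0 e)
      _ = 2 := by rw [← Finset.sum_mul, hp1, one_mul]
  obtain ⟨hTl, hTu⟩ := abs_le.1 hT2
  refine ⟨1 / 2 - T / 8, ⟨by linarith, by linarith⟩, fun a b c => ?_⟩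
  have hsum : ∑ e : E, ∑ x : ZMod 2, ∑ y : ZMod 2, ∑ i : ZMod 2, ∑ j : ZMod 2,
      p e * A e x i * B e y j * (if c = x * y + i + j + a + b then 1 else 0)
        = 2 + (if c = a + b then 1 else -1) * T / 2 :=
    calc _ = ∑ e, p e * (2 + (if c = a + b then 1 else -1) *
            chsh (bias (A e)) (bias (B e)) / 2) := by
          refine Finset.sum_congr rfl fun e _ => ?_
          rw [← sum_mul_ite_eq_chsh (hA1 e) (hB1 e) a b c]
          simp only [Finset.mul_sum, mul_assoc]
      _ = (∑ e, p e) * 2 + (if c = a + b then 1 else -1) * T / 2 := by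
          rw [hT, Finset.sum_mul, Finset.mul_sum, Finset.sum_div, ← Finset.sum_add_distrib]
          exact Finset.sum_congr rfl fun e _ => by ring
      _ = _ := by rw [hp1, one_mul]
  rw [hsum, bsc]
  split_ifs <;> ring
end

section
/- Let Λ ∈ [0, 1/2) and ν ∈ [0,1]. Then the minimax value sup over probability distributions p on {0,1} with min{p(0), p(1)} > Λ of the infimum over probability distributions q on {0,1} with q(1) ≤ Λ of I(p; q(0)·BSC(ν) + q(1)·BSC(1−ν)) equals 1 − max_{0 ≤ τ ≤ Λ} h(ν + τ(1−2ν)). (Note q(0)·BSC(ν)+q(1)·BSC(1−ν) = BSC(ν + q(1)(1−2ν)), and the outer supremum is attained at the uniform distribution.) -/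
/-- Base-2 Shannon entropy of a (sub)distribution on a finite set,
with the convention `0·log 0 = 0` (automatic since `Real.logb 2 0 = 0`). -/
noncomputable def shannonH {α : Type*} [Fintype α] (p : α → ℝ) : ℝ :=
  -∑ a, p a * Real.logb 2 (p a)

/-- Binary entropy `h(x) = −x·log₂ x − (1−x)·log₂(1−x)`. -/
noncomputable def binH (x : ℝ) : ℝ :=
  -(x * Real.logb 2 x) - (1 - x) * Real.logb 2 (1 - x)

/-- Mutual information `I(p;W) = H(p) + H(Wp) − H((W,p))` of an input distribution
`p` on `α` and a channel `W` from `α` to `{0,1}` (here `W c z = W(c|z)`). -/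
noncomputable def mutInfo {α : Type*} [Fintype α] (p : α → ℝ)
    (W : ZMod 2 → α → ℝ) : ℝ :=
  shannonH p + shannonH (fun c => ∑ z, W c z * p z)
    - shannonH (fun q : ZMod 2 × α => W q.1 q.2 * p q.2)

theorem binH_eq_binEntropy_div (x : ℝ) : binH x = Real.binEntropy x / Real.log 2 := by
  simp only [binH, Real.logb, Real.binEntropy, Real.log_inv]
  ring

theorem binH_le_one (x : ℝ) : binH x ≤ 1 := by
  rw [binH_eq_binEntropy_div, div_le_one (Real.log_pos one_lt_two)]
  exact Real.binEntropy_le_log_two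

theorem binH_nonneg {x : ℝ} (h₀ : 0 ≤ x) (h₁ : x ≤ 1) : 0 ≤ binH x := by
  rw [binH_eq_binEntropy_div]
  exact div_nonneg (Real.binEntropy_nonneg h₀ h₁) (Real.log_pos one_lt_two).le

theorem binH_one_half : binH (1 / 2) = 1 := by
  rw [binH_eq_binEntropy_div, one_div, Real.binEntropy_two_inv,
    div_self (Real.log_pos one_lt_two).ne']

theorem sum_zmod_two (f : ZMod 2 → ℝ) : ∑ x, f x = f 0 + f 1 :=
  Fin.sum_univ_two f

theorem mul_mul_logb_mul (x y : ℝ) :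
    x * y * Real.logb 2 (x * y) = y * (x * Real.logb 2 x) + x * (y * Real.logb 2 y) := by
  have h := Real.negMulLog_mul x y
  simp only [Real.negMulLog] at h
  simp only [Real.logb]
  linear_combination (-1 / Real.log 2) * h

/-- A mixture of a binary symmetric channel and its flip is again binary symmetric. -/
theorem bsc_mixture (ν : ℝ) {q : ZMod 2 → ℝ} (hq : ∑ s, q s = 1) (c z : ZMod 2) :
    q 0 * bsc ν c z + q 1 * bsc (1 - ν) c z = bsc (ν + q 1 * (1 - 2 * ν)) c z := by
  rw [sum_zmod_two] at hq
  obtain h : q 0 = 1 - q 1 := by linarith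
  unfold bsc
  split_ifs <;> rw [h] <;> ring

/-- The mutual information of a binary symmetric channel is the output entropy minus the
noise entropy. -/
theorem mutInfo_bsc (t : ℝ) {p : ZMod 2 → ℝ} (hp : ∑ x, p x = 1) :
    mutInfo p (bsc t) = binH (t * p 0 + (1 - t) * p 1) - binH t := by
  rw [sum_zmod_two] at hp
  have h10 : (1 : ZMod 2) ≠ 0 := by decide
  have hout : (1 - t) * p 0 + t * p 1 = 1 - (t * p 0 + (1 - t) * p 1) := by
    linear_combination hp
  simp only [mutInfo, shannonH, Fintype.sum_prod_type, sum_zmod_two, bsc, if_true, h10,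
    h10.symm, if_false, hout, mul_mul_logb_mul, binH]
  linear_combination (t * Real.logb 2 t + (1 - t) * Real.logb 2 (1 - t)) * hp

/-- for `Λ ∈ [0,1/2)` and `ν ∈ [0,1]`, the minimax value
`sup_{p : min{p₀,p₁} > Λ} inf_{q : q₁ ≤ Λ} I(p; q₀·BSC(ν) + q₁·BSC(1−ν))`
equals `1 − max_{0 ≤ τ ≤ Λ} h(ν + τ(1−2ν))`. -/
theorem minimax_capacity_formula (Λ ν : ℝ)
    (hΛ : Λ ∈ Set.Ico (0:ℝ) (1/2)) (hν : ν ∈ Set.Icc (0:ℝ) 1) :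
    sSup {v : ℝ | ∃ p : ZMod 2 → ℝ,
        (∀ x, 0 ≤ p x) ∧ (∑ x, p x = 1) ∧ Λ < min (p 0) (p 1) ∧
        v = sInf {w : ℝ | ∃ q : ZMod 2 → ℝ,
            (∀ s, 0 ≤ q s) ∧ (∑ s, q s = 1) ∧ q 1 ≤ Λ ∧
            w = mutInfo p
                  (fun c z => q 0 * bsc ν c z + q 1 * bsc (1 - ν) c z)}}
      = 1 - sSup {y : ℝ | ∃ τ ∈ Set.Icc (0:ℝ) Λ, y = binH (ν + τ * (1 - 2*ν))} := by
  obtain ⟨hΛ0, hΛ1⟩ := hΛ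
  obtain ⟨hν0, hν1⟩ := hν
  have hflip : ∀ τ : ℝ, 0 ≤ τ → τ ≤ 1 →
      0 ≤ ν + τ * (1 - 2 * ν) ∧ ν + τ * (1 - 2 * ν) ≤ 1 := fun τ h0 h1 =>
    ⟨by nlinarith [mul_nonneg h0 (sub_nonneg.2 hν1), mul_nonneg hν0 (sub_nonneg.2 h1)],
      by nlinarith [mul_nonneg h0 hν0, mul_nonneg (sub_nonneg.2 hν1) (sub_nonneg.2 h1)]⟩
  set S := sSup {y : ℝ | ∃ τ ∈ Set.Icc (0:ℝ) Λ, y = binH (ν + τ * (1 - 2*ν))} with hS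
  have hSbdd : BddAbove {y : ℝ | ∃ τ ∈ Set.Icc (0:ℝ) Λ, y = binH (ν + τ * (1 - 2*ν))} := by
    refine ⟨1, ?_⟩
    rintro _ ⟨τ, -, rfl⟩
    exact binH_le_one _
  have hSne : {y : ℝ | ∃ τ ∈ Set.Icc (0:ℝ) Λ, y = binH (ν + τ * (1 - 2*ν))}.Nonempty :=
    ⟨_, 0, ⟨le_rfl, hΛ0⟩, rfl⟩
  have hinfo : ∀ p q : ZMod 2 → ℝ, ∑ x, p x = 1 → ∑ s, q s = 1 →
      mutInfo p (fun c z => q 0 * bsc ν c z + q 1 * bsc (1 - ν) c z) =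
        binH ((ν + q 1 * (1 - 2 * ν)) * p 0 + (1 - (ν + q 1 * (1 - 2 * ν))) * p 1)
          - binH (ν + q 1 * (1 - 2 * ν)) := by
    intro p q hp hq
    rw [← mutInfo_bsc _ hp]
    congr 1
    funext c z
    exact bsc_mixture ν hq c z
  let q : ℝ → ZMod 2 → ℝ := fun τ s => if s = 0 then 1 - τ else τ
  have hq0 : ∀ τ, q τ 0 = 1 - τ := fun τ => if_pos rfl
  have hq1 : ∀ τ, q τ 1 = τ := fun τ => if_neg (by decide)
  have hqsum : ∀ τ, ∑ s, q τ s = 1 := fun τ => by rw [sum_zmod_two, hq0, hq1]; ring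
  have hqnn : ∀ τ, 0 ≤ τ → τ ≤ Λ → ∀ s, 0 ≤ q τ s := by
    intro τ h0 h1 s
    simp only [q]
    split_ifs <;> linarith
  have hq1_le : ∀ q : ZMod 2 → ℝ, (∀ s, 0 ≤ q s) → ∑ s, q s = 1 → q 1 ≤ 1 := by
    intro q h hs
    rw [sum_zmod_two] at hs
    linarith [h 0]
  have hupper : ∀ p : ZMod 2 → ℝ, (∀ x, 0 ≤ p x) → ∑ x, p x = 1 →
      sInf {w : ℝ | ∃ q : ZMod 2 → ℝ,
            (∀ s, 0 ≤ q s) ∧ (∑ s, q s = 1) ∧ q 1 ≤ Λ ∧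
            w = mutInfo p
                  (fun c z => q 0 * bsc ν c z + q 1 * bsc (1 - ν) c z)} ≤ 1 - S := by
    intro p hp hps
    rw [le_sub_comm]
    refine csSup_le hSne ?_
    rintro _ ⟨τ, ⟨hτ0, hτ1⟩, rfl⟩
    rw [le_sub_comm]
    have hbdd : BddBelow {w : ℝ | ∃ q : ZMod 2 → ℝ,
            (∀ s, 0 ≤ q s) ∧ (∑ s, q s = 1) ∧ q 1 ≤ Λ ∧
            w = mutInfo p
                  (fun c z => q 0 * bsc ν c z + q 1 * bsc (1 - ν) c z)} := by
      refine ⟨-1, ?_⟩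
      rintro _ ⟨q, hq, hqs, -, rfl⟩
      rw [hinfo p q hps hqs]
      obtain ⟨h0, h1⟩ := hflip (q 1) (hq 1) (hq1_le q hq hqs)
      rw [sum_zmod_two] at hps
      have hout0 := binH_nonneg
        (x := (ν + q 1 * (1 - 2 * ν)) * p 0 + (1 - (ν + q 1 * (1 - 2 * ν))) * p 1)
        (add_nonneg (mul_nonneg h0 (hp 0)) (mul_nonneg (sub_nonneg.2 h1) (hp 1)))
        (by linarith [mul_nonneg h0 (hp 1), mul_nonneg (sub_nonneg.2 h1) (hp 0)])
      linarith [binH_le_one (ν + q 1 * (1 - 2 * ν))]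
    refine (csInf_le hbdd ⟨q τ, hqnn τ hτ0 hτ1, hqsum τ, (hq1 τ).trans_le hτ1, rfl⟩).trans ?_
    rw [hinfo p (q τ) hps (hqsum τ), hq1]
    linarith [binH_le_one ((ν + τ * (1 - 2 * ν)) * p 0 + (1 - (ν + τ * (1 - 2 * ν))) * p 1)]
  have hunif : ∑ _x : ZMod 2, (1 / 2 : ℝ) = 1 := by rw [sum_zmod_two]; norm_num
  refine IsGreatest.csSup_eq ⟨?_, ?_⟩
  · refine ⟨fun _ => 1 / 2, fun _ => by norm_num, hunif, by simpa using hΛ1, ?_⟩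
    refine le_antisymm (le_csInf ?_ ?_) (hupper _ (fun _ => by norm_num) hunif)
    · exact ⟨_, q 0, hqnn 0 le_rfl hΛ0, hqsum 0, (hq1 0).trans_le hΛ0, rfl⟩
    · rintro _ ⟨q, hq, hqs, hqΛ, rfl⟩
      rw [hinfo _ q hunif hqs, show ∀ t : ℝ, t * (1 / 2) + (1 - t) * (1 / 2) = 1 / 2 by
        intro t; ring, binH_one_half]
      exact sub_le_sub_left (le_csSup hSbdd ⟨q 1, ⟨hq 1, hqΛ⟩, rfl⟩) 1
  · rintro _ ⟨p, hp, hps, -, rfl⟩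
    exact hupper p hp hps
end

section
/- Let t ∈ [−1/4, 1/4] and define the correlation q(α,β|x,y) := 1/4 + (−1)^{α⊕β⊕(x·y)}·t for α,β,x,y ∈ {0,1} (for each (x,y) this is a probability distribution on (α,β)). Then for all a, b, c ∈ {0,1}: (1/4)·∑_{x,y,α,β ∈ {0,1}} q(α,β|x,y)·[c = x·y ⊕ α ⊕ β ⊕ a ⊕ b] = BSC(1/2 − 2t)(c | a⊕b). In particular, for the Popescu–Rohrlich value t = 1/4 the effective channel is the noiseless binary adder channel, and for the EPR value t = 1/(4√2) it is the adder channel followed by a BSC with flip probability (2−√2)/4. -/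
/-- The correlation `q(α,β|x,y) = 1/4 + (−1)^{α⊕β⊕(x·y)}·t`. -/
noncomputable def qCorr (t : ℝ) (α β x y : ZMod 2) : ℝ :=
  1/4 + (-1 : ℝ) ^ (α + β + x * y).val * t

/-- For each `x`, `y`, `α`, exactly one `β` satisfies the indicator, so one
sum over a single bit already gives the effective channel. -/
lemma sum_qCorr_mul_indicator (t : ℝ) (x y α a b c : ZMod 2) :
    ∑ β : ZMod 2, qCorr t α β x y * (if c = x * y + α + β + a + b then 1 else 0)
      = 1/4 + (-1 : ℝ) ^ (c + (a + b)).val * t := by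
  have key : ∀ β : ZMod 2,
      c = x * y + α + β + a + b ↔ β = c + x * y + α + a + b := by
    revert x y α a b c; decide
  have parity : α + (c + x * y + α + a + b) + x * y = c + (a + b) := by
    revert x y α a b c; decide
  simp [key, qCorr, parity]

lemma one_quarter_add_sign_mul (t : ℝ) (c z : ZMod 2) :
    4 * (1/4 + (-1 : ℝ) ^ (c + z).val * t) = 2 * bsc (1/2 - 2*t) c z := by
  have hval : (c + z).val = if c = z then 0 else 1 := by
    revert c z; decide
  rw [hval, bsc]
  split_ifs <;> ring

lemma qCorr_nonneg {t : ℝ} (ht : t ∈ Set.Icc (-(1/4) : ℝ) (1/4)) (α β x y : ZMod 2) :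
    0 ≤ qCorr t α β x y := by
  obtain ⟨h₁, h₂⟩ := ht
  rcases neg_one_pow_eq_or ℝ (α + β + x * y).val with h | h <;> rw [qCorr, h] <;> linarith

lemma sum_qCorr (t : ℝ) (x y : ZMod 2) :
    ∑ α : ZMod 2, ∑ β : ZMod 2, qCorr t α β x y = 1 := by
  have shift (α : ZMod 2) : ∑ β : ZMod 2, qCorr t α β x y = 1/2 := by
    have h := Equiv.sum_comp (Equiv.addLeft (α + x * y))
      (fun s : ZMod 2 => 1/4 + (-1 : ℝ) ^ s.val * t)
    have hs : ∑ s : ZMod 2, (1/4 + (-1 : ℝ) ^ s.val * t) = 1/2 := by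
      change ∑ s : Fin 2, (1/4 + (-1 : ℝ) ^ s.val * t) = 1/2
      rw [Fin.sum_univ_two]
      simp only [Fin.val_zero, Fin.val_one, pow_zero, pow_one]
      ring
    rw [← hs, ← h]
    refine Finset.sum_congr rfl fun β _ => ?_
    simp only [qCorr, Equiv.coe_addLeft, add_right_comm α β]
  simp [shift, ZMod.card]

/-- for `t ∈ [−1/4, 1/4]`, `q(α,β|x,y) = 1/4 + (−1)^{α⊕β⊕x·y} t` is a
probability distribution on `(α,β)` for each `(x,y)`, and the induced effective
multiple-access channel is the binary adder channel followed by `BSC(1/2 − 2t)`.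
In particular `t = 1/4` (Popescu–Rohrlich) gives the noiseless adder channel and
`t = 1/(4√2)` (EPR) gives flip probability `(2−√2)/4`. -/
theorem correlation_modulated_effective_channel
    (t : ℝ) (ht : t ∈ Set.Icc (-(1/4) : ℝ) (1/4)) :
    (∀ x y : ZMod 2,
        (∀ α β : ZMod 2, 0 ≤ qCorr t α β x y) ∧
        (∑ α : ZMod 2, ∑ β : ZMod 2, qCorr t α β x y = 1)) ∧
    (∀ a b c : ZMod 2,
        (1/4 : ℝ) * ∑ x : ZMod 2, ∑ y : ZMod 2, ∑ α : ZMod 2, ∑ β : ZMod 2,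
            qCorr t α β x y * (if c = x * y + α + β + a + b then 1 else 0)
          = bsc (1/2 - 2*t) c (a + b)) ∧
    ((1/2 : ℝ) - 2 * (1/4) = 0) ∧
    ((1/2 : ℝ) - 2 * (1/(4 * Real.sqrt 2)) = (2 - Real.sqrt 2) / 4) := by
  refine ⟨fun x y => ⟨fun α β => qCorr_nonneg ht α β x y, sum_qCorr t x y⟩,
    fun a b c => ?_, by norm_num, ?_⟩
  · have h := one_quarter_add_sign_mul t c (a + b)
    simp only [sum_qCorr_mul_indicator, Finset.sum_const, Finset.card_univ, ZMod.card,
      nsmul_eq_mul]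
    push_cast
    linarith
  · have h : Real.sqrt 2 * Real.sqrt 2 = 2 := Real.mul_self_sqrt (by norm_num)
    have h0 : Real.sqrt 2 ≠ 0 := by positivity
    field_simp
    linarith
end
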